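/- arXiv:1702.06195 — 5 statements merged into one kernel-verified Lean document; each statement's English description precedes it below -/
import Mathlib

section
/- Let g be a real function that is (i+j)-times continuously differentiable on an open interval containing [u,v], where u < v, i ≥ 1 and j ≥ 1. Define L(u,v) = (g(v) − g(u))/(v − u) and _iM_j(u,v) = ∂^{i+j}/(∂u^i ∂v^j) L(u,v). Then i · _{i−1}M_j(u,v) = (v − u) · _iM_j(u,v) + j · _iM_{j−1}(u,v). -/
/-- `L(u,v) = (g(v) - g(u))/(v - u)`. -/
noncomputable def divDiff (g : ℝ → ℝ) (u v : ℝ) : ℝ := (g v - g u) / (v - u)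

/-- The mixed partial derivative `_iM_j(u,v) = ∂^{i+j}/(∂u^i ∂v^j) L(u,v)`. -/
noncomputable def mixedM (g : ℝ → ℝ) (i j : ℕ) (u v : ℝ) : ℝ :=
  iteratedDeriv i (fun x => iteratedDeriv j (fun y => divDiff g x y) v) u

theorem iter_lin (n : ℕ) (c x : ℝ) (f : ℝ → ℝ) (hf : ContDiffAt ℝ ((n + 1 : ℕ)) f x) :
    iteratedDeriv (n + 1) (fun y => (y - c) * f y) x =
      (x - c) * iteratedDeriv (n + 1) f x + ((n + 1 : ℕ) : ℝ) * iteratedDeriv n f x := by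
  have hl : ContDiffAt ℝ ((n + 1 : ℕ)) (fun y : ℝ => y - c) x := by fun_prop
  have h := iteratedDeriv_mul hl hf
  have e : (fun y => (y - c) * f y) = (fun y => y - c) * f := rfl
  have d1 : deriv (fun y : ℝ => y - c) = fun _ => 1 := by
    ext y; simp
  rw [e, h, Finset.sum_range_succ', Finset.sum_range_succ']
  rw [Finset.sum_eq_zero]
  · simp [iteratedDeriv_succ', d1]
    ring
  · intro k _
    simp [iteratedDeriv_succ', d1]

theorem rec_y (g : ℝ → ℝ) (x v : ℝ) (n : ℕ) (hx : x < v)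
    (hg : ContDiffAt ℝ ((n + 1 : ℕ)) g v) :
    (v - x) * iteratedDeriv (n + 1) (fun y => divDiff g x y) v
      + ((n + 1 : ℕ) : ℝ) * iteratedDeriv n (fun y => divDiff g x y) v
      = iteratedDeriv (n + 1) g v := by
  have hne : v - x ≠ 0 := by linarith
  have hF : ContDiffAt ℝ ((n + 1 : ℕ)) (fun y => divDiff g x y) v := by
    unfold divDiff
    exact (hg.sub contDiffAt_const).div (contDiffAt_id.sub contDiffAt_const) hne
  rw [← iter_lin n x v _ hF]
  have he : (fun y => (y - x) * divDiff g x y) =ᶠ[nhds v] fun y => -g x + g y := by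
    filter_upwards [lt_mem_nhds hx] with y hy
    have : y - x ≠ 0 := by linarith
    unfold divDiff
    field_simp
    ring
  rw [he.iteratedDeriv_eq, iteratedDeriv_const_add (Nat.succ_pos n)]

theorem smooth_x (g : ℝ → ℝ) (u v : ℝ) (m : ℕ) (huv : u < v)
    (hu : ContDiffAt ℝ m g u) (n : ℕ) (hv : ContDiffAt ℝ n g v) :
    ContDiffAt ℝ m (fun x => iteratedDeriv n (fun y => divDiff g x y) v) u := by
  have hne : v - u ≠ 0 := by linarith
  induction n with
  | zero =>
    simp only [iteratedDeriv_zero, divDiff]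
    exact (contDiffAt_const.sub hu).div (contDiffAt_const.sub contDiffAt_id) hne
  | succ n ih =>
    have ih' := ih (hv.of_le (by exact_mod_cast Nat.le_succ n))
    have h : ContDiffAt ℝ m (fun x => (iteratedDeriv (n + 1) g v
        - ((n + 1 : ℕ) : ℝ) * iteratedDeriv n (fun y => divDiff g x y) v) / (v - x)) u :=
      (contDiffAt_const.sub (contDiffAt_const.mul ih')).div
        (contDiffAt_const.sub contDiffAt_id) hne
    refine h.congr_of_eventuallyEq ?_
    filter_upwards [gt_mem_nhds huv] with x hx
    have : v - x ≠ 0 := by linarith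
    rw [← rec_y g x v n hx hv]
    field_simp
    ring

/-- Identity (14) (Lemma 1 of Yanev et al. (2008)):
`i · _{i-1}M_j(u,v) = (v - u) · _iM_j(u,v) + j · _iM_{j-1}(u,v)`. -/
theorem stmt_1 (g : ℝ → ℝ) (u v a b : ℝ) (i j : ℕ) (hi : 1 ≤ i) (hj : 1 ≤ j)
    (huv : u < v) (hau : a < u) (hvb : v < b)
    (hg : ContDiffOn ℝ (i + j) g (Set.Ioo a b)) :
    (i : ℝ) * mixedM g (i - 1) j u v =
      (v - u) * mixedM g i j u v + (j : ℝ) * mixedM g i (j - 1) u v := by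
  obtain ⟨i, rfl⟩ := Nat.exists_eq_add_of_le' hi
  obtain ⟨j, rfl⟩ := Nat.exists_eq_add_of_le' hj
  have hu0 := hg.contDiffAt (Ioo_mem_nhds hau (huv.trans hvb))
  have hv0 := hg.contDiffAt (Ioo_mem_nhds (hau.trans huv) hvb)
  have hu : ContDiffAt ℝ ((i + 1 : ℕ)) g u :=
    hu0.of_le (by exact_mod_cast Nat.le_add_right _ _)
  have hv : ContDiffAt ℝ ((j + 1 : ℕ)) g v :=
    hv0.of_le (by exact_mod_cast Nat.le_add_left _ _)
  have hD1 := smooth_x g u v (i + 1) huv hu (j + 1) hv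
  have hD0 := smooth_x g u v (i + 1) huv hu j (hv.of_le (by exact_mod_cast Nat.le_succ j))
  simp only [Nat.add_sub_cancel, mixedM]
  have hl := iter_lin i v u _ hD1
  have he : (fun x => (x - v) * iteratedDeriv (j + 1) (fun y => divDiff g x y) v) =ᶠ[nhds u]
      fun x => -iteratedDeriv (j + 1) g v
        + ((j + 1 : ℕ) : ℝ) * iteratedDeriv j (fun y => divDiff g x y) v := by
    filter_upwards [gt_mem_nhds huv] with x hx
    rw [← rec_y g x v j hx hv]
    ring
  rw [he.iteratedDeriv_eq, iteratedDeriv_const_add (Nat.succ_pos i),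
    iteratedDeriv_const_mul_field] at hl
  linarith
end

section
/- Let s ≥ 1 be an integer and let g be a real function that is s-times continuously differentiable on an open interval containing [u,v], where u < v. Then ∫_u^v g^{(s)}(t) (t − u)^{s−1} dt = (v − u)^s · ∂^{s−1}/∂v^{s−1} ((g(v) − g(u))/(v − u)). Equivalently, E[g^{(s)}(B_{1,s}(u,v))] = (1/B(1,s)) · _0M_{s−1}(u,v). -/
theorem aux_cont (g : ℝ → ℝ) (a b : ℝ) (s k : ℕ) (hk : k ≤ s)
    (hg : ContDiffOn ℝ s g (Set.Ioo a b)) : ContinuousOn (iteratedDeriv k g) (Set.Ioo a b) := by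
  have h := hg.continuousOn_iteratedDerivWithin (m := k) (by exact_mod_cast hk)
    isOpen_Ioo.uniqueDiffOn
  exact h.congr (fun x hx => (iteratedDerivWithin_of_isOpen isOpen_Ioo hx).symm)

theorem aux_deriv (g : ℝ → ℝ) (a b : ℝ) (s k : ℕ) (hk : k < s)
    (hg : ContDiffOn ℝ s g (Set.Ioo a b)) (x : ℝ) (hx : x ∈ Set.Ioo a b) :
    HasDerivAt (iteratedDeriv k g) (iteratedDeriv (k + 1) g x) x := by
  have h := hg.differentiableOn_iteratedDerivWithin (m := k) (by exact_mod_cast hk)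
    isOpen_Ioo.uniqueDiffOn
  have h2 := h.congr (fun x hx => (iteratedDerivWithin_of_isOpen (f := g) (n := k) isOpen_Ioo hx).symm)
  have h3 := (h2.differentiableAt (isOpen_Ioo.mem_nhds hx)).hasDerivAt
  rwa [iteratedDeriv_succ]

theorem aux_main (g : ℝ → ℝ) (u a b : ℝ) (n : ℕ) (hau : a < u) :
    ContDiffOn ℝ (n + 1 : ℕ) g (Set.Ioo a b) → ∀ v, u < v → v < b →
    ∫ t in u..v, iteratedDeriv (n + 1) g t * (t - u) ^ n =
      (v - u) ^ (n + 1) * iteratedDeriv n (fun y => (g y - g u) / (y - u)) v := by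
  induction n with
  | zero =>
    intro hg v huv hvb
    have hsub : Set.uIcc u v ⊆ Set.Ioo a b := by
      rw [Set.uIcc_of_le huv.le]
      exact fun x hx => ⟨hau.trans_le hx.1, hx.2.trans_lt hvb⟩
    have h1 := intervalIntegral.integral_eq_sub_of_hasDerivAt
      (f := iteratedDeriv 0 g) (f' := iteratedDeriv (0 + 1) g) (a := u) (b := v)
      (fun x hx => aux_deriv g a b _ 0 (by omega) hg x (hsub hx))
      (((aux_cont g a b _ _ le_rfl hg).mono hsub).intervalIntegrable)
    have hne : v - u ≠ 0 := by linarith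
    simp only [pow_zero, mul_one, h1, iteratedDeriv_zero]
    field_simp
    ring
  | succ n ih =>
    intro hg v huv hvb
    have ih' := ih (hg.of_le (by exact_mod_cast Nat.le_succ _))
    have hsub : Set.uIcc u v ⊆ Set.Ioo a b := by
      rw [Set.uIcc_of_le huv.le]
      exact fun x hx => ⟨hau.trans_le hx.1, hx.2.trans_lt hvb⟩
    have hc1 := aux_cont g a b _ (n + 1) (by omega) hg
    have hc2 := aux_cont g a b _ (n + 1 + 1) (by omega) hg
    have hne : v - u ≠ 0 := by linarith
    have hvm : v ∈ Set.Ioo a b := ⟨by linarith, hvb⟩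
    have hC1 : ContinuousOn (fun t => iteratedDeriv (n + 1) g t * (t - u) ^ n) (Set.Ioo a b) :=
      hc1.mul (by fun_prop)
    have hi1 := (hC1.mono hsub).intervalIntegrable (μ := MeasureTheory.volume)
    have hi2 : IntervalIntegrable (fun t => iteratedDeriv (n + 1 + 1) g t * (t - u) ^ (n + 1))
        MeasureTheory.volume u v :=
      ((hc2.mul (by fun_prop)).mono hsub).intervalIntegrable
    have parts := intervalIntegral.integral_eq_sub_of_hasDerivAt (a := u) (b := v)
      (f := fun t => iteratedDeriv (n + 1) g t * (t - u) ^ (n + 1))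
      (f' := fun t => iteratedDeriv (n + 1 + 1) g t * (t - u) ^ (n + 1) +
        (n + 1 : ℝ) * (iteratedDeriv (n + 1) g t * (t - u) ^ n))
      (fun x hx => by
        have h := (aux_deriv g a b _ (n + 1) (by omega) hg x (hsub hx)).mul
          (((hasDerivAt_id x).sub_const u).pow (n + 1))
        refine h.congr_deriv ?_
        simp only [Pi.pow_apply, id, Nat.add_sub_cancel, mul_one, Nat.cast_add, Nat.cast_one]
        ring)
      (hi2.add (hi1.const_mul _))
    rw [intervalIntegral.integral_add hi2 (hi1.const_mul _),
      intervalIntegral.integral_const_mul] at parts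
    have hI : HasDerivAt (fun y => ∫ t in u..y, iteratedDeriv (n + 1) g t * (t - u) ^ n)
        (iteratedDeriv (n + 1) g v * (v - u) ^ n) v :=
      intervalIntegral.integral_hasDerivAt_right hi1
        (hC1.stronglyMeasurableAtFilter isOpen_Ioo v hvm)
        (hC1.continuousAt (isOpen_Ioo.mem_nhds hvm))
    have hQ := hI.div (((hasDerivAt_id v).sub_const u).pow (n + 1)) (pow_ne_zero _ hne)
    have hev : iteratedDeriv n (fun y => (g y - g u) / (y - u)) =ᶠ[nhds v]
        (fun y => ∫ t in u..y, iteratedDeriv (n + 1) g t * (t - u) ^ n) /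
          (fun y => id y - u) ^ (n + 1) := by
      filter_upwards [isOpen_Ioo.mem_nhds (show v ∈ Set.Ioo u b from ⟨huv, hvb⟩)] with y hy
      have hy0 : y - u ≠ 0 := by linarith [hy.1]
      simp only [Pi.div_apply, Pi.pow_apply, id, ih' y hy.1 hy.2]
      field_simp
    have hD := (hQ.congr_of_eventuallyEq hev).deriv
    rw [iteratedDeriv_succ (n := n) (f := fun y => (g y - g u) / (y - u)), hD]
    simp only [Pi.pow_apply, id, sub_self, ne_eq, Nat.succ_ne_zero, not_false_eq_true, zero_pow,
      mul_zero, sub_zero, Nat.add_sub_cancel, mul_one, Nat.cast_add, Nat.cast_one] at parts ⊢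
    rw [← eq_sub_iff_add_eq] at parts
    rw [parts]
    field_simp
    try ring

/-- Case `r = 1` of equation (exp_M):
`∫_u^v g^{(s)}(t) (t-u)^{s-1} dt = (v-u)^s ∂^{s-1}/∂v^{s-1} ((g(v)-g(u))/(v-u))`,
i.e. `E[g^{(s)}(B_{1,s}(u,v))] = (1/B(1,s)) · _0M_{s-1}(u,v)`. -/
theorem stmt_2 (g : ℝ → ℝ) (u v a b : ℝ) (s : ℕ) (hs : 1 ≤ s)
    (huv : u < v) (hau : a < u) (hvb : v < b)
    (hg : ContDiffOn ℝ s g (Set.Ioo a b)) :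
    ∫ t in u..v, iteratedDeriv s g t * (t - u) ^ (s - 1) =
      (v - u) ^ s * iteratedDeriv (s - 1) (fun y => (g y - g u) / (y - u)) v := by
  obtain ⟨n, rfl⟩ : ∃ n, s = n + 1 := ⟨s - 1, by omega⟩
  exact aux_main g u a b n hau hg v huv hvb
end

section
/- Let j ≥ 1 and s ≥ 2 be integers, u < v, and let g be a real function that is (s+j)-times continuously differentiable on an open interval containing [u,v]. Define I(j,s) = ∫_u^v g^{(s+j−1)}(t) (t − u)^{s−1} (v − t)^{j−1} dt. Then I(j+1, s) = j · I(j, s) − (s − 1) · I(j+1, s−1). -/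
/-- `I(j,s) = ∫_u^v g^{(s+j-1)}(t) (t-u)^{s-1} (v-t)^{j-1} dt`. -/
noncomputable def Iint (g : ℝ → ℝ) (u v : ℝ) (j s : ℕ) : ℝ :=
  ∫ t in u..v, iteratedDeriv (s + j - 1) g t * (t - u) ^ (s - 1) * (v - t) ^ (j - 1)

/-- The integration-by-parts recurrence `I(j+1, s) = j·I(j, s) − (s−1)·I(j+1, s−1)`. -/
theorem stmt_4 (g : ℝ → ℝ) (u v a b : ℝ) (j s : ℕ) (hj : 1 ≤ j) (hs : 2 ≤ s)
    (huv : u < v) (hau : a < u) (hvb : v < b)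
    (hg : ContDiffOn ℝ (s + j) g (Set.Ioo a b)) :
    Iint g u v (j + 1) s =
      (j : ℝ) * Iint g u v j s - ((s : ℝ) - 1) * Iint g u v (j + 1) (s - 1) := by
  obtain ⟨p, rfl⟩ : ∃ p, s = p + 2 := ⟨s - 2, by omega⟩
  obtain ⟨q, rfl⟩ : ∃ q, j = q + 1 := ⟨j - 1, by omega⟩
  have hg' : ContDiffOn ℝ ((p + q + 3 : ℕ) : WithTop ℕ∞) g (Set.Ioo a b) := by
    have h : p + q + 3 = (p + 2) + (q + 1) := by omega
    rw [h]
    exact_mod_cast hg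
  have hsub : Set.uIcc u v ⊆ Set.Ioo a b := by
    rw [Set.uIcc_of_le huv.le]
    exact Set.Icc_subset_Ioo hau hvb
  have hud : UniqueDiffOn ℝ (Set.Ioo a b) := isOpen_Ioo.uniqueDiffOn
  have hc : ∀ n ≤ p + q + 3, ContinuousOn (iteratedDeriv n g) (Set.uIcc u v) := by
    intro n hn
    refine ContinuousOn.mono ?_ hsub
    exact (hg'.continuousOn_iteratedDerivWithin (by exact_mod_cast hn) hud).congr
      (fun x hx => (iteratedDerivWithin_of_isOpen isOpen_Ioo hx).symm)
  have hd : ∀ t ∈ Set.uIcc u v, HasDerivAt (iteratedDeriv (p + q + 2) g)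
      (iteratedDeriv (p + q + 3) g t) t := by
    intro t ht
    have h1 : DifferentiableOn ℝ (iteratedDeriv (p + q + 2) g) (Set.Ioo a b) :=
      (hg'.differentiableOn_iteratedDerivWithin (m := p + q + 2)
        (by exact_mod_cast Nat.lt_succ_self _) hud).congr
        (fun x hx => (iteratedDerivWithin_of_isOpen isOpen_Ioo hx).symm)
    have h2 := (h1.differentiableAt (isOpen_Ioo.mem_nhds (hsub ht))).hasDerivAt
    rwa [← iteratedDeriv_succ] at h2
  have hc2 := hc (p + q + 2) (by omega)
  have hc3 := hc (p + q + 3) le_rfl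
  unfold Iint
  rw [show p + 2 + (q + 1 + 1) - 1 = p + q + 3 by omega,
    show p + 2 + (q + 1) - 1 = p + q + 2 by omega,
    show p + 2 - 1 + (q + 1 + 1) - 1 = p + q + 2 by omega,
    show p + 2 - 1 = p + 1 by omega, show p + 1 - 1 = p by omega,
    show q + 1 + 1 - 1 = q + 1 by omega, show q + 1 - 1 = q by omega]
  have i1 : IntervalIntegrable (fun t => iteratedDeriv (p + q + 3) g t * (t - u) ^ (p + 1)
      * (v - t) ^ (q + 1)) MeasureTheory.volume u v :=
    ContinuousOn.intervalIntegrable (by fun_prop)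
  have i2 : IntervalIntegrable (fun t => iteratedDeriv (p + q + 2) g t * (t - u) ^ (p + 1)
      * (v - t) ^ q) MeasureTheory.volume u v :=
    ContinuousOn.intervalIntegrable (by fun_prop)
  have i3 : IntervalIntegrable (fun t => iteratedDeriv (p + q + 2) g t * (t - u) ^ p
      * (v - t) ^ (q + 1)) MeasureTheory.volume u v :=
    ContinuousOn.intervalIntegrable (by fun_prop)
  have i2' := i2.const_mul ((q : ℝ) + 1)
  have i3' := i3.const_mul ((p : ℝ) + 1)
  have key := intervalIntegral.integral_eq_sub_of_hasDerivAt (a := u) (b := v)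
    (f := fun t => iteratedDeriv (p + q + 2) g t * (t - u) ^ (p + 1) * (v - t) ^ (q + 1))
    (f' := fun t => iteratedDeriv (p + q + 3) g t * (t - u) ^ (p + 1) * (v - t) ^ (q + 1)
      - ((q : ℝ) + 1) * (iteratedDeriv (p + q + 2) g t * (t - u) ^ (p + 1) * (v - t) ^ q)
      + ((p : ℝ) + 1) * (iteratedDeriv (p + q + 2) g t * (t - u) ^ p * (v - t) ^ (q + 1)))
    (by
      intro t ht
      have e1 := ((hasDerivAt_id t).sub_const u).pow (p + 1)
      have e2 := ((hasDerivAt_id t).const_sub v).pow (q + 1)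
      have e := ((hd t ht).mul e1).mul e2
      refine e.congr_deriv ?_
      simp
      ring)
    ((i1.sub i2').add i3')
  rw [intervalIntegral.integral_add (i1.sub i2') i3', intervalIntegral.integral_sub i1 i2',
    intervalIntegral.integral_const_mul, intervalIntegral.integral_const_mul] at key
  simp at key
  push_cast
  linear_combination key
end

section
/- Let j ≥ 1 and s ≥ 2 be integers, u < v, and let g be a real function that is (s+j)-times continuously differentiable on an open interval containing [u,v]. Define I(j,s) = ∫_u^v g^{(s+j−1)}(t) (t − u)^{s−1} (v − t)^{j−1} dt and coefficients a_0 = 1 and a_i = (−1)^i (s−1)!/(s−1−i)! for i = 1, …, s−1. Then I(j+1, s) = j · Σ_{i=0}^{s−2} a_i · I(j, s−i) + a_{s−1} · ∫_u^v g^{(j+1)}(t) (v − t)^j dt. -/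
/-- The coefficients `a_0 = 1`, `a_i = (−1)^i (s−1)!/(s−1−i)!`. -/
noncomputable def aCoef (s i : ℕ) : ℝ :=
  (-1 : ℝ) ^ i * (Nat.factorial (s - 1)) / (Nat.factorial (s - 1 - i))

lemma smooth_aux (g : ℝ → ℝ) (a b : ℝ) (N : ℕ) (hg : ContDiffOn ℝ N g (Set.Ioo a b)) :
    (∀ n ≤ N, ContinuousOn (iteratedDeriv n g) (Set.Ioo a b)) ∧
    (∀ n < N, ∀ t ∈ Set.Ioo a b,
      HasDerivAt (iteratedDeriv n g) (iteratedDeriv (n + 1) g t) t) := by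
  have ho : IsOpen (Set.Ioo a b) := isOpen_Ioo
  constructor
  · intro n hn
    exact (hg.continuousOn_iteratedDerivWithin (by exact_mod_cast hn) ho.uniqueDiffOn).congr
      (fun x hx => (iteratedDerivWithin_of_isOpen ho hx).symm)
  · intro n hn t ht
    have h1 := hg.differentiableOn_iteratedDerivWithin (m := n) (by exact_mod_cast hn)
      ho.uniqueDiffOn
    have h2 : DifferentiableOn ℝ (iteratedDeriv n g) (Set.Ioo a b) :=
      h1.congr (fun x hx => (iteratedDerivWithin_of_isOpen ho hx).symm)
    rw [iteratedDeriv_succ]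
    exact (h2.differentiableAt (ho.mem_nhds ht)).hasDerivAt

lemma Iint_rec (g : ℝ → ℝ) (u v a b : ℝ) (k m : ℕ)
    (huv : u < v) (hau : a < u) (hvb : v < b)
    (hg : ContDiffOn ℝ (m + k + 3 : ℕ) g (Set.Ioo a b)) :
    Iint g u v (k + 2) (m + 2) =
      (k + 1 : ℝ) * Iint g u v (k + 1) (m + 2) - (m + 1 : ℝ) * Iint g u v (k + 2) (m + 1) := by
  obtain ⟨hc, hd⟩ := smooth_aux g a b _ hg
  have hsub : Set.uIcc u v ⊆ Set.Ioo a b := by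
    rw [Set.uIcc_of_le huv.le]
    exact fun x hx => ⟨hau.trans_le hx.1, hx.2.trans_lt hvb⟩
  have hint : ∀ n ≤ m + k + 3, ∀ p q : ℕ, IntervalIntegrable
      (fun t => iteratedDeriv n g t * (t - u) ^ p * (v - t) ^ q) MeasureTheory.volume u v := by
    intro n hn p q
    apply ContinuousOn.intervalIntegrable
    have := (hc n hn).mono hsub
    fun_prop
  have e1 : m + 2 + (k + 2) - 1 = m + k + 3 := by omega
  have e2 : m + 2 + (k + 1) - 1 = m + k + 2 := by omega
  have e3 : m + 1 + (k + 2) - 1 = m + k + 2 := by omega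
  have e4 : m + 2 - 1 = m + 1 := by omega
  have e5 : k + 2 - 1 = k + 1 := by omega
  unfold Iint
  rw [e1, e2, e3, e4, e5, Nat.add_sub_cancel, Nat.add_sub_cancel]
  have i1 := hint (m + k + 3) le_rfl (m + 1) (k + 1)
  have i2 := (hint (m + k + 2) (by omega) (m + 1) k).const_mul (k + 1 : ℝ)
  have i3 := (hint (m + k + 2) (by omega) m (k + 1)).const_mul (m + 1 : ℝ)
  have key := intervalIntegral.integral_eq_sub_of_hasDerivAt (a := u) (b := v)
    (f := fun t => iteratedDeriv (m + k + 2) g t * (t - u) ^ (m + 1) * (v - t) ^ (k + 1))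
    (f' := fun t => iteratedDeriv (m + k + 3) g t * (t - u) ^ (m + 1) * (v - t) ^ (k + 1)
      - (k + 1 : ℝ) * (iteratedDeriv (m + k + 2) g t * (t - u) ^ (m + 1) * (v - t) ^ k)
      + (m + 1 : ℝ) * (iteratedDeriv (m + k + 2) g t * (t - u) ^ m * (v - t) ^ (k + 1)))
    (fun t ht => by
      have h1 := hd (m + k + 2) (by omega) t (hsub ht)
      have h2 := ((hasDerivAt_id t).sub_const u).pow (m + 1)
      have h3 := ((hasDerivAt_id t).const_sub v).pow (k + 1)
      refine ((h1.mul h2).mul h3).congr_deriv ?_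
      simp
      ring)
    ((i1.sub i2).add i3)
  rw [intervalIntegral.integral_add (i1.sub i2) i3, intervalIntegral.integral_sub i1 i2,
    intervalIntegral.integral_const_mul, intervalIntegral.integral_const_mul] at key
  simp only [sub_self, ne_eq, Nat.succ_ne_zero, not_false_eq_true, zero_pow, mul_zero,
    zero_mul] at key
  linarith

lemma aCoef_succ (m i : ℕ) : aCoef (m + 2) (i + 1) = -(m + 1 : ℝ) * aCoef (m + 1) i := by
  unfold aCoef
  have e1 : m + 2 - 1 = m + 1 := by omega
  have e2 : m + 1 - (i + 1) = m - i := by omega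
  rw [e1, e2, Nat.add_sub_cancel, Nat.factorial_succ]
  push_cast
  ring

lemma aCoef_zero (m : ℕ) : aCoef m 0 = 1 := by
  unfold aCoef
  have : ((m - 1).factorial : ℝ) ≠ 0 := by positivity
  simp [this]

lemma main_aux (g : ℝ → ℝ) (u v a b : ℝ) (k m : ℕ)
    (huv : u < v) (hau : a < u) (hvb : v < b)
    (hg : ContDiffOn ℝ (m + k + 2 : ℕ) g (Set.Ioo a b)) :
    Iint g u v (k + 2) (m + 1) =
      (k + 1 : ℝ) * ∑ i ∈ Finset.range m, aCoef (m + 1) i * Iint g u v (k + 1) (m + 1 - i) +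
        aCoef (m + 1) m * ∫ t in u..v, iteratedDeriv (k + 2) g t * (v - t) ^ (k + 1) := by
  induction m with
  | zero =>
    have e : 0 + 1 + (k + 2) - 1 = k + 2 := by omega
    simp [aCoef_zero, Iint, e]
  | succ m ih =>
    have hg' : ContDiffOn ℝ (m + k + 3 : ℕ) g (Set.Ioo a b) := by
      convert hg using 2
      omega
    rw [Iint_rec g u v a b k m huv hau hvb hg',
      ih (hg'.of_le (by exact_mod_cast (by omega : m + k + 2 ≤ m + k + 3))),
      Finset.sum_range_succ']
    have h : ∀ i, aCoef (m + 1 + 1) (i + 1) * Iint g u v (k + 1) (m + 1 + 1 - (i + 1))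
        = -(m + 1 : ℝ) * (aCoef (m + 1) i * Iint g u v (k + 1) (m + 1 - i)) := by
      intro i
      rw [aCoef_succ, Nat.add_sub_add_right]
      ring
    simp only [h]
    rw [← Finset.mul_sum, aCoef_succ, aCoef_zero, Nat.sub_zero]
    ring

/-- Equation (integral2):
`I(j+1, s) = j Σ_{i=0}^{s−2} a_i I(j, s−i) + a_{s−1} ∫_u^v g^{(j+1)}(t) (v−t)^j dt`. -/
theorem stmt_6 (g : ℝ → ℝ) (u v a b : ℝ) (j s : ℕ) (hj : 1 ≤ j) (hs : 2 ≤ s)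
    (huv : u < v) (hau : a < u) (hvb : v < b)
    (hg : ContDiffOn ℝ (s + j) g (Set.Ioo a b)) :
    Iint g u v (j + 1) s =
      (j : ℝ) * ∑ i ∈ Finset.range (s - 1), aCoef s i * Iint g u v j (s - i) +
        aCoef s (s - 1) * ∫ t in u..v, iteratedDeriv (j + 1) g t * (v - t) ^ j := by
  obtain ⟨k, rfl⟩ : ∃ k, j = k + 1 := ⟨j - 1, by omega⟩
  obtain ⟨m, rfl⟩ : ∃ m, s = m + 1 := ⟨s - 1, by omega⟩
  have h := main_aux g u v a b k m huv hau hvb (by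
    convert hg using 1
    push_cast
    norm_cast
    omega)
  rw [Nat.add_sub_cancel]
  push_cast
  exact h
end

section
/- Let c > 0, l be real, n, r, s be integers with r ≥ 1 and 1 ≤ s ≤ n − 1, and let f(x) = c·e^{−c(x−l)}. Define f_n(x) = c^n (x − l)^n / n! · f(x) and, for m < k, f_{m,k}(x_m, x_k) = c^k (x_m − l)^m (x_k − x_m)^{k−m−1} / (m! (k−m−1)!) · f(x_k). Then for all l < u < x < v, f_{n,n+r}(x, v) · f_{n−s,n}(u, x) / (f_n(x) · f_{n−s,n+r}(u, v)) = (1/B(r,s)) · (x − u)^{s−1}(v − x)^{r−1}/(v − u)^{r+s−1}, where B(·,·) is the Beta function. -/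
/-- The Beta function `B(r,s) = Γ(r)Γ(s)/Γ(r+s)`. -/
noncomputable def betaFn (r s : ℝ) : ℝ := Real.Gamma r * Real.Gamma s / Real.Gamma (r + s)

/-- The exponential density `f(x) = c e^{-c(x-l)}`. -/
noncomputable def expDens (c l x : ℝ) : ℝ := c * Real.exp (-c * (x - l))

/-- The marginal density of the `n`-th record value: `f_n(x) = c^n (x-l)^n/n! · f(x)`. -/
noncomputable def recDens (c l : ℝ) (n : ℕ) (x : ℝ) : ℝ :=
  c ^ n * (x - l) ^ n / (Nat.factorial n) * expDens c l x

/-- The joint density of the `m`-th and `k`-th record values (`m < k`):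
`f_{m,k}(x_m,x_k) = c^k (x_m-l)^m (x_k-x_m)^{k-m-1}/(m!(k-m-1)!) · f(x_k)`. -/
noncomputable def recDens2 (c l : ℝ) (m k : ℕ) (xm xk : ℝ) : ℝ :=
  c ^ k * (xm - l) ^ m * (xk - xm) ^ (k - m - 1) /
    ((Nat.factorial m) * (Nat.factorial (k - m - 1))) * expDens c l xk

/-- The conditional density of `R_n` given `R_{n-s} = u` and `R_{n+r} = v` for
exponential record values is the four-parameter Beta density (the computation in the
proof of the Proposition). -/
theorem stmt_9 (c l : ℝ) (hc : 0 < c) (n r s : ℕ) (hr : 1 ≤ r) (hs : 1 ≤ s)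
    (hsn : s ≤ n - 1) (u x v : ℝ) (hlu : l < u) (hux : u < x) (hxv : x < v) :
    recDens2 c l n (n + r) x v * recDens2 c l (n - s) n u x /
        (recDens c l n x * recDens2 c l (n - s) (n + r) u v) =
      (1 / betaFn r s) * ((x - u) ^ (s - 1) * (v - x) ^ (r - 1) / (v - u) ^ (r + s - 1)) := by
  obtain ⟨a, rfl⟩ : ∃ a, r = a + 1 := ⟨r - 1, by omega⟩
  obtain ⟨b, rfl⟩ : ∃ b, s = b + 1 := ⟨s - 1, by omega⟩
  obtain ⟨m, rfl⟩ : ∃ m, n = m + (b + 1) := ⟨n - (b + 1), by omega⟩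
  have e1 : m + (b + 1) + (a + 1) - (m + (b + 1)) - 1 = a := by omega
  have e2 : m + (b + 1) - (b + 1) = m := by omega
  have e3 : m + (b + 1) - m - 1 = b := by omega
  have e4 : m + (b + 1) + (a + 1) - m - 1 = a + b + 1 := by omega
  have e5 : a + 1 + (b + 1) - 1 = a + b + 1 := by omega
  have g1 : Real.Gamma ((a + 1 : ℕ) : ℝ) = (Nat.factorial a : ℝ) := by
    rw [← Real.Gamma_nat_eq_factorial]; push_cast; rfl
  have g2 : Real.Gamma ((b + 1 : ℕ) : ℝ) = (Nat.factorial b : ℝ) := by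
    rw [← Real.Gamma_nat_eq_factorial]; push_cast; rfl
  have g3 : Real.Gamma (((a + 1 : ℕ) : ℝ) + ((b + 1 : ℕ) : ℝ))
      = (Nat.factorial (a + b + 1) : ℝ) := by
    rw [← Real.Gamma_nat_eq_factorial]; congr 1; push_cast; ring
  unfold recDens2 recDens betaFn expDens
  rw [e2, e1, e3, e4, e5, g1, g2, g3, Nat.add_sub_cancel, Nat.add_sub_cancel]
  have h1 : c ≠ 0 := hc.ne'
  have h2 : x - l ≠ 0 := by intro h; linarith
  have h3 : u - l ≠ 0 := by intro h; linarith
  have h4 : v - u ≠ 0 := by intro h; linarith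
  have f1 : (Nat.factorial a : ℝ) ≠ 0 := by positivity
  have f2 : (Nat.factorial b : ℝ) ≠ 0 := by positivity
  have f3 : (Nat.factorial m : ℝ) ≠ 0 := by positivity
  have f4 : (Nat.factorial (m + (b + 1)) : ℝ) ≠ 0 := by positivity
  have f5 : (Nat.factorial (a + b + 1) : ℝ) ≠ 0 := by positivity
  have x1 := Real.exp_ne_zero (-c * (x - l))
  have x2 := Real.exp_ne_zero (-c * (v - l))
  have p1 : c ^ (m + (b + 1)) ≠ 0 := pow_ne_zero _ h1
  have p2 : c ^ (m + (b + 1) + (a + 1)) ≠ 0 := pow_ne_zero _ h1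
  have p3 : (x - l) ^ (m + (b + 1)) ≠ 0 := pow_ne_zero _ h2
  have p4 : (u - l) ^ m ≠ 0 := pow_ne_zero _ h3
  have p5 : (v - u) ^ (a + b + 1) ≠ 0 := pow_ne_zero _ h4
  generalize Real.exp (-c * (x - l)) = X at *
  generalize Real.exp (-c * (v - l)) = V at *
  generalize c ^ (m + (b + 1)) = C1 at *
  generalize c ^ (m + (b + 1) + (a + 1)) = C2 at *
  generalize (x - l) ^ (m + (b + 1)) = Y at *
  generalize (u - l) ^ m = U at *
  generalize (v - u) ^ (a + b + 1) = W at *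
  generalize (x - u) ^ b = P at *
  generalize (v - x) ^ a = Q at *
  clear g1 g2 g3
  field_simp
end
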